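/- arXiv:2003.08062 — 3 statements merged into one kernel-verified Lean document; each statement's English description precedes it below -/
import Mathlib

section
/- Let (λ, σ, u) be an eigenmode on (Σ, V) (the continuous problem) and let (λ_h, σ_h, u_h) be an eigenmode on a discretization (Σ_h, V_h). Then the eigenvalue–eigenfunction error relation λ − λ_h = ‖σ − σ_h‖_A² − λ_h ‖u − u_h‖² holds. -/
open scoped InnerProductSpace

/-- Let `(lam, σ, u)` be an eigenmode on `(X, V)` (the continuous problem)
and let `(lamh, σh, uh)` be an eigenmode on a discretization `(Sh, Vh)`.  Then the
eigenvalue–eigenfunction error relation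
`lam - lamh = ‖σ - σh‖_A² - lamh * ‖u - uh‖²` holds. -/
theorem eigenvalue_error_relation
    {X V : Type*}
    [NormedAddCommGroup X] [InnerProductSpace ℝ X] [CompleteSpace X]
    [NormedAddCommGroup V] [InnerProductSpace ℝ V] [CompleteSpace V]
    -- the bilinear form `a`, symmetric and positive semidefinite
    (a : X →ₗ[ℝ] X →ₗ[ℝ] ℝ)
    (ha_symm : ∀ x y : X, a x y = a y x)
    (ha_psd : ∀ x : X, 0 ≤ a x x)
    -- the linear map `B` abstracting the divergence operator
    (B : X →ₗ[ℝ] V)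
    -- an eigenmode `(lam, σ, u)` of the continuous problem, i.e. on `(X, V)`
    (lam : ℝ) (σ : X) (u : V)
    (hnorm : ‖u‖ = 1)
    (heq1 : ∀ τ : X, a σ τ + ⟪B τ, u⟫_ℝ = 0)
    (heq2 : ∀ v : V, ⟪B σ, v⟫_ℝ = -(lam * ⟪u, v⟫_ℝ))
    -- a discretization `(Sh, Vh)`
    (Sh : Submodule ℝ X) (Vh : Submodule ℝ V)
    (hdisc : ∀ τ ∈ Sh, B τ ∈ Vh)
    -- an eigenmode `(lamh, σh, uh)` on `(Sh, Vh)`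
    (lamh : ℝ) (σh : X) (uh : V)
    (hσh : σh ∈ Sh) (huh : uh ∈ Vh)
    (hnormh : ‖uh‖ = 1)
    (heq1h : ∀ τ ∈ Sh, a σh τ + ⟪B τ, uh⟫_ℝ = 0)
    (heq2h : ∀ v ∈ Vh, ⟪B σh, v⟫_ℝ = -(lamh * ⟪uh, v⟫_ℝ)) :
    lam - lamh = a (σ - σh) (σ - σh) - lamh * ‖u - uh‖ ^ 2 := by
  have hBσh : B σh = -(lamh • uh) := by
    have hmem : B σh + lamh • uh ∈ Vh := Vh.add_mem (hdisc σh hσh) (Vh.smul_mem lamh huh)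
    have hzero : ⟪B σh + lamh • uh, B σh + lamh • uh⟫_ℝ = 0 := by
      rw [inner_add_left, heq2h _ hmem, real_inner_smul_left]
      ring
    exact eq_neg_of_add_eq_zero_left (inner_self_eq_zero.mp hzero)
  have hσσ : a σ σ = lam := by
    have h := heq1 σ
    rw [heq2, real_inner_self_eq_norm_sq, hnorm] at h
    linarith
  have hσhσh : a σh σh = lamh := by
    have h := heq1h σh hσh
    rw [heq2h _ huh, real_inner_self_eq_norm_sq, hnormh] at h
    linarith
  have hσσh : a σ σh = lamh * ⟪u, uh⟫_ℝ := by
    have h := heq1 σh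
    rw [hBσh, inner_neg_left, real_inner_smul_left, real_inner_comm] at h
    linarith
  rw [norm_sub_sq_real, hnorm, hnormh]
  simp only [map_sub, LinearMap.sub_apply]
  rw [ha_symm σh σ, hσσ, hσhσh, hσσh]
  ring
end

section
/- Let (Σ_H, V_H) and (Σ_h, V_h) be discretizations with Σ_H ⊆ Σ_h and V_H ⊆ V_h (nested discretizations), and let (λ_H, σ_H, u_H) and (λ_h, σ_h, u_h) be eigenmodes on (Σ_H, V_H) and (Σ_h, V_h) respectively. Then λ_h − λ_H = ‖σ_h − σ_H‖_A² − λ_H ‖u_h − u_H‖². -/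
open scoped InnerProductSpace

/-- Let `(SH, VH)` and `(Sh, Vh)` be nested discretizations
(`SH ⊆ Sh`, `VH ⊆ Vh`) and let `(lamH, σH, uH)` and `(lamh, σh, uh)` be eigenmodes
on `(SH, VH)` and `(Sh, Vh)` respectively.  Then
`lamh - lamH = ‖σh - σH‖_A² - lamH * ‖uh - uH‖²`. -/
theorem discrete_eigenvalue_error_relation
    {X V : Type*}
    [NormedAddCommGroup X] [InnerProductSpace ℝ X] [CompleteSpace X]
    [NormedAddCommGroup V] [InnerProductSpace ℝ V] [CompleteSpace V]
    -- the bilinear form `a`, symmetric and positive semidefinite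
    (a : X →ₗ[ℝ] X →ₗ[ℝ] ℝ)
    (ha_symm : ∀ x y : X, a x y = a y x)
    (ha_psd : ∀ x : X, 0 ≤ a x x)
    -- the linear map `B` abstracting the divergence operator
    (B : X →ₗ[ℝ] V)
    -- nested discretizations `(SH, VH)` and `(Sh, Vh)`
    (SH Sh : Submodule ℝ X) (VH Vh : Submodule ℝ V)
    (hdiscH : ∀ τ ∈ SH, B τ ∈ VH)
    (hdisch : ∀ τ ∈ Sh, B τ ∈ Vh)
    (hSnested : SH ≤ Sh) (hVnested : VH ≤ Vh)
    -- an eigenmode `(lamH, σH, uH)` on `(SH, VH)`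
    (lamH : ℝ) (σH : X) (uH : V)
    (hσH : σH ∈ SH) (huH : uH ∈ VH)
    (hnormH : ‖uH‖ = 1)
    (heq1H : ∀ τ ∈ SH, a σH τ + ⟪B τ, uH⟫_ℝ = 0)
    (heq2H : ∀ v ∈ VH, ⟪B σH, v⟫_ℝ = -(lamH * ⟪uH, v⟫_ℝ))
    -- an eigenmode `(lamh, σh, uh)` on `(Sh, Vh)`
    (lamh : ℝ) (σh : X) (uh : V)
    (hσh : σh ∈ Sh) (huh : uh ∈ Vh)
    (hnormh : ‖uh‖ = 1)
    (heq1h : ∀ τ ∈ Sh, a σh τ + ⟪B τ, uh⟫_ℝ = 0)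
    (heq2h : ∀ v ∈ Vh, ⟪B σh, v⟫_ℝ = -(lamh * ⟪uh, v⟫_ℝ)) :
    lamh - lamH = a (σh - σH) (σh - σH) - lamH * ‖uh - uH‖ ^ 2 := by
  have hB : B σH = -(lamH • uH) := by
    rw [← sub_eq_zero, ← inner_self_eq_zero (𝕜 := ℝ)]
    have hmem : B σH - -(lamH • uH) ∈ VH :=
      VH.sub_mem (hdiscH σH hσH) (VH.neg_mem (VH.smul_mem lamH huH))
    nth_rewrite 1 [inner_sub_left]
    rw [heq2H _ hmem, inner_neg_left, real_inner_smul_left, sub_self]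
  have hinnerH : ⟪uH, uH⟫_ℝ = 1 := by rw [real_inner_self_eq_norm_sq, hnormH, one_pow]
  have hinnerh : ⟪uh, uh⟫_ℝ = 1 := by rw [real_inner_self_eq_norm_sq, hnormh, one_pow]
  have hHH := heq1H σH hσH
  rw [heq2H uH huH, hinnerH] at hHH
  have hhh := heq1h σh hσh
  rw [heq2h uh huh, hinnerh] at hhh
  have hhH := heq1h σH (hSnested hσH)
  rw [hB, inner_neg_left, real_inner_smul_left, real_inner_comm] at hhH
  rw [norm_sub_sq_real, hnormH, hnormh]
  simp only [map_sub, LinearMap.sub_apply]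
  rw [ha_symm σH σh]
  linear_combination 2 * hhH - hHH - hhh
end

section
/- Let (Σ_H, V_H) and (Σ_h, V_h) be discretizations with Σ_H ⊆ Σ_h and V_H ⊆ V_h (nested discretizations), and let (λ_H, σ_H, u_H) and (λ_h, σ_h, u_h) be eigenmodes on (Σ_H, V_H) and (Σ_h, V_h) respectively. Then |λ_h − λ_H| ≤ max(‖σ_h − σ_H‖_A², λ_H ‖u_h − u_H‖²); in particular λ_h − λ_H ≤ ‖σ_h − σ_H‖_A² and λ_H − λ_h ≤ λ_H ‖u_h − u_H‖². -/
open scoped InnerProductSpace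

/-- Let `(SH, VH)` and `(Sh, Vh)` be nested discretizations
(`SH ⊆ Sh`, `VH ⊆ Vh`) and let `(lamH, σH, uH)` and `(lamh, σh, uh)` be eigenmodes on
`(SH, VH)` and `(Sh, Vh)` respectively.  Then
`|lamh - lamH| ≤ max (‖σh - σH‖_A²) (lamH * ‖uh - uH‖²)`; in particular
`lamh - lamH ≤ ‖σh - σH‖_A²` and `lamH - lamh ≤ lamH * ‖uh - uH‖²`. -/
theorem discrete_eigenvalue_error_bound
    {X V : Type*}
    [NormedAddCommGroup X] [InnerProductSpace ℝ X] [CompleteSpace X]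
    [NormedAddCommGroup V] [InnerProductSpace ℝ V] [CompleteSpace V]
    -- the bilinear form `a`, symmetric and positive semidefinite
    (a : X →ₗ[ℝ] X →ₗ[ℝ] ℝ)
    (ha_symm : ∀ x y : X, a x y = a y x)
    (ha_psd : ∀ x : X, 0 ≤ a x x)
    -- the linear map `B` abstracting the divergence operator
    (B : X →ₗ[ℝ] V)
    -- nested discretizations `(SH, VH)` and `(Sh, Vh)`
    (SH Sh : Submodule ℝ X) (VH Vh : Submodule ℝ V)
    (hdiscH : ∀ τ ∈ SH, B τ ∈ VH)
    (hdisch : ∀ τ ∈ Sh, B τ ∈ Vh)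
    (hSnested : SH ≤ Sh) (hVnested : VH ≤ Vh)
    -- an eigenmode `(lamH, σH, uH)` on `(SH, VH)`
    (lamH : ℝ) (σH : X) (uH : V)
    (hσH : σH ∈ SH) (huH : uH ∈ VH)
    (hnormH : ‖uH‖ = 1)
    (heq1H : ∀ τ ∈ SH, a σH τ + ⟪B τ, uH⟫_ℝ = 0)
    (heq2H : ∀ v ∈ VH, ⟪B σH, v⟫_ℝ = -(lamH * ⟪uH, v⟫_ℝ))
    -- an eigenmode `(lamh, σh, uh)` on `(Sh, Vh)`
    (lamh : ℝ) (σh : X) (uh : V)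
    (hσh : σh ∈ Sh) (huh : uh ∈ Vh)
    (hnormh : ‖uh‖ = 1)
    (heq1h : ∀ τ ∈ Sh, a σh τ + ⟪B τ, uh⟫_ℝ = 0)
    (heq2h : ∀ v ∈ Vh, ⟪B σh, v⟫_ℝ = -(lamh * ⟪uh, v⟫_ℝ)) :
    |lamh - lamH| ≤ max (a (σh - σH) (σh - σH)) (lamH * ‖uh - uH‖ ^ 2) ∧
      lamh - lamH ≤ a (σh - σH) (σh - σH) ∧
      lamH - lamh ≤ lamH * ‖uh - uH‖ ^ 2 := by
  have hBσH : B σH = -(lamH • uH) := by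
    have hmem : B σH + lamH • uH ∈ VH :=
      VH.add_mem (hdiscH σH hσH) (VH.smul_mem lamH huH)
    have hzero : ⟪B σH + lamH • uH, B σH + lamH • uH⟫_ℝ = 0 := by
      rw [inner_add_left, heq2H _ hmem, real_inner_smul_left]
      ring
    exact eq_neg_of_add_eq_zero_left (inner_self_eq_zero.mp hzero)
  have hlamH : a σH σH = lamH := by
    have h₁ := heq1H σH hσH
    rw [heq2H uH huH, real_inner_self_eq_norm_sq, hnormH] at h₁
    linarith
  have hlamh : a σh σh = lamh := by
    have h₁ := heq1h σh hσh
    rw [heq2h uh huh, real_inner_self_eq_norm_sq, hnormh] at h₁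
    linarith
  have hcross : a σh σH = lamH * ⟪uh, uH⟫_ℝ := by
    have h₁ := heq1h σH (hSnested hσH)
    rw [hBσH, inner_neg_left, real_inner_smul_left, real_inner_comm] at h₁
    linarith
  have hexpand : a (σh - σH) (σh - σH) = lamh + lamH - 2 * (lamH * ⟪uh, uH⟫_ℝ) := by
    simp only [map_sub, LinearMap.sub_apply]
    rw [ha_symm σH σh, hlamH, hlamh, hcross]
    ring
  have hidentity :
      lamh - lamH = a (σh - σH) (σh - σH) - lamH * ‖uh - uH‖ ^ 2 := by
    rw [hexpand, norm_sub_sq_real, hnormh, hnormH]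
    ring
  have hA := ha_psd (σh - σH)
  have hL : 0 ≤ lamH * ‖uh - uH‖ ^ 2 :=
    mul_nonneg (hlamH ▸ ha_psd σH) (sq_nonneg _)
  have hupper : lamh - lamH ≤ a (σh - σH) (σh - σH) := by linarith
  have hlower : lamH - lamh ≤ lamH * ‖uh - uH‖ ^ 2 := by linarith
  refine ⟨abs_le'.mpr ⟨le_max_of_le_left hupper, le_max_of_le_right ?_⟩, hupper, hlower⟩
  rwa [neg_sub]
end
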